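/- For every n ≥ 2, the type D_n zeta map ζ_D is a bijection from the set L•_{n−1,n} of signed lattice paths onto the set B•_{2n−1} of signed ballot paths. -/

import Mathlib

inductive Step
  | N : Step
  | E : Step
  deriving DecidableEq

/-- The number of East steps strictly preceding the `k`-th North step. -/
def ebn : List Step → ℕ → ℕ
  | _, 0 => 0
  | [], _ + 1 => 0
  | Step.E :: rest, k + 1 => ebn rest (k + 1) + 1
  | Step.N :: rest, k + 1 => ebn rest k

/-- A lattice path with `a` East steps and `b` North steps. -/
def IsLatticePath (a b : ℕ) (π : List Step) : Prop :=
  π.count Step.E = a ∧ π.count Step.N = b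

/-- A ballot path of length `m`: every prefix has at least as many `N`s as `E`s. -/
def IsBallotPath (m : ℕ) (β : List Step) : Prop :=
  β.length = m ∧ ∀ k : ℕ, (β.take k).count Step.E ≤ (β.take k).count Step.N

/-- `i` is a rise: the `i`-th North step is immediately followed by a North step. -/
def IsRise (π : List Step) (i : ℕ) : Prop :=
  ∃ p : ℕ, π[p]? = some Step.N ∧ π[p + 1]? = some Step.N ∧ (π.take p).count Step.N + 1 = i

/-- `(i,j)` is a valley: the `i`-th East step is immediately followed by the `j`-th North
step; in addition if the path ends with an East step and consists of `i` East steps and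
`j - 1` North steps, then `(i, j)` counts as a valley. -/
def IsValley (β : List Step) (i j : ℕ) : Prop :=
  (∃ p : ℕ, β[p]? = some Step.E ∧ β[p + 1]? = some Step.N ∧
      (β.take p).count Step.E + 1 = i ∧ (β.take (p + 1)).count Step.N + 1 = j) ∨
  (β.getLast? = some Step.E ∧ i = β.count Step.E ∧ j = β.count Step.N + 1)

/-- Read `a` from left to right, writing `N` for each entry `j` and `E` for each entry `j+1`. -/
def sPlusL (j : ℤ) (a : List ℤ) : List Step :=
  a.filterMap fun x => if x = j then some Step.N else if x = j + 1 then some Step.E else none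

/-- Read `a` from right to left, writing `N` for each entry `j` and `E` for each entry `j+1`. -/
def sPlusR (j : ℤ) (a : List ℤ) : List Step := sPlusL j a.reverse

/-- Read `a` from left to right, writing `N` for each entry `-j` and `E` for each entry `-j-1`. -/
def sMinusL (j : ℤ) (a : List ℤ) : List Step :=
  a.filterMap fun x => if x = -j then some Step.N else if x = -j - 1 then some Step.E else none

/-- Read `a` from right to left, writing `N` for each entry `-j` and `E` for each entry `-j-1`. -/
def sMinusR (j : ℤ) (a : List ℤ) : List Step := sMinusL j a.reverse

/-- A possibly signed path: a path together with a sign `ε ∈ {1, -1}` carried by the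
distinguished signed East step (the sign is `1` whenever there is no signed step). -/
structure SPath where
  path : List Step
  sgn : ℤ

/-- The `k`-th North step is immediately followed by an East step. -/
def NthNFollowedByE (β : List Step) (k : ℕ) : Prop :=
  ∃ p : ℕ, β[p]? = some Step.N ∧ (β.take p).count Step.N + 1 = k ∧ β[p + 1]? = some Step.E

/-- Signed lattice paths `L•_{n-1,n}`: the first step may carry a sign if it is an East step. -/
def IsSignedLatticePath (n : ℕ) (π : SPath) : Prop :=
  IsLatticePath (n - 1) n π.path ∧ (π.sgn = 1 ∨ π.sgn = -1) ∧
    (π.path.head? = some Step.N → π.sgn = 1)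

/-- Signed ballot paths `B•_{2n-1}`: the East step following the `n`-th North step (if any)
may carry a sign. -/
def IsSignedBallotPath (n : ℕ) (β : SPath) : Prop :=
  IsBallotPath (2 * n - 1) β.path ∧ (β.sgn = 1 ∨ β.sgn = -1) ∧
    (¬ NthNFollowedByE β.path n → β.sgn = 1)

/-- The vector `λ(π)` of a signed lattice path (1-based index). -/
def lamD (n : ℕ) (π : SPath) (i : ℕ) : ℤ :=
  if i = 1 then π.sgn * (ebn π.path 1 : ℤ)
  else if i = n then
    (if (∑ k ∈ Finset.Icc 1 (n - 2), ebn π.path k) % 2 = 0 then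
        2 * (ebn π.path n : ℤ) - (ebn π.path (n - 1) : ℤ)
      else 2 * (n : ℤ) - 1 - 2 * (ebn π.path n : ℤ) + (ebn π.path (n - 1) : ℤ))
  else (ebn π.path i : ℤ)

/-- The type `Dₙ` area vector (1-based index). -/
def areaD (n : ℕ) (π : SPath) (i : ℕ) : ℤ :=
  if i = 1 then
    (if (n - 1) % 4 = 0 ∨ (n - 1) % 4 = 3 then lamD n π 1 else -lamD n π 1)
  else if i = n then
    (if (n - 1) % 4 = 0 ∨ (n - 1) % 4 = 3 then lamD n π n - ((n : ℤ) - 1)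
      else (n : ℤ) - lamD n π n)
  else lamD n π i - ((i : ℤ) - 1)

def areaDList (n : ℕ) (π : SPath) : List ℤ :=
  (List.range n).map fun k => areaD n π (k + 1)

/-- The underlying (unsigned) path of the image of the type `Dₙ` zeta map. -/
def zetaDraw (n : ℕ) (π : SPath) : List Step :=
  (((List.range (2 * n)).reverse.map (fun j =>
    sMinusR (j : ℤ) (areaDList n π) ++ sPlusL (j : ℤ) (areaDList n π))).flatten).dropLast

-- The type `Dₙ` zeta map on signed lattice paths.
open scoped Classical in
noncomputable def zetaD (n : ℕ) (π : SPath) : SPath where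
  path := zetaDraw n π
  sgn :=
    if NthNFollowedByE (zetaDraw n π) n then
      (if ((Finset.Icc 1 n).filter (fun r => 0 < areaD n π r)).card % 2 = 0 then 1 else -1)
    else 1


open List

/-- The word that a single entry `x` contributes to `sPlusL j`. -/
def levelLetter (j x : ℤ) : List Step :=
  if x = j then [Step.N] else if x = j + 1 then [Step.E] else []

/-- Consecutive entries of `d` drop by at most one. -/
def Gentle (d : List ℤ) : Prop := d.IsChain fun a b => a - 1 ≤ b

/-- The sequence read from right to left with all signs changed. -/
def negRev (d : List ℤ) : List ℤ := (d.map Neg.neg).reverse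

/-- Exchange of the two kinds of steps. -/
def Step.swap : Step → Step
  | N => E
  | E => N

/-- The concatenation `w (m - 1) ++ ⋯ ++ w 1 ++ w 0`. -/
def sweep (m : ℕ) (w : ℕ → List Step) : List Step :=
  ((List.range m).reverse.map w).flatten

section Sweep

lemma sweep_zero (w : ℕ → List Step) : sweep 0 w = [] := rfl

lemma sweep_succ (m : ℕ) (w : ℕ → List Step) : sweep (m + 1) w = w m ++ sweep m w := by
  simp [sweep, List.range_succ]

lemma sweep_succ' (m : ℕ) (w : ℕ → List Step) :
    sweep (m + 1) w = sweep m (fun j => w (j + 1)) ++ w 0 := by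
  induction m with
  | zero => simp [sweep]
  | succ m ih => rw [sweep_succ, ih, sweep_succ, List.append_assoc]

lemma count_sweep_append (s : Step) (m : ℕ) (u v : ℕ → List Step) :
    (sweep m fun j => u j ++ v j).count s = (sweep m u).count s + (sweep m v).count s := by
  induction m with
  | zero => rfl
  | succ m ih => simp only [sweep_succ, List.count_append, ih]; omega

lemma length_eq_count_add_count (l : List Step) :
    l.length = l.count Step.N + l.count Step.E := by
  induction l with
  | nil => rfl
  | cons s l ih => cases s <;> simp [ih] <;> omega

end Sweep

section Levels

lemma sPlusL_nil (j : ℤ) : sPlusL j [] = [] := rfl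

lemma sPlusL_cons (j x : ℤ) (d : List ℤ) :
    sPlusL j (x :: d) = levelLetter j x ++ sPlusL j d := by
  unfold sPlusL levelLetter
  rw [List.filterMap_cons]
  split_ifs <;> rfl

lemma sPlusL_append (j : ℤ) (c d : List ℤ) :
    sPlusL j (c ++ d) = sPlusL j c ++ sPlusL j d := List.filterMap_append

lemma sPlusL_singleton (j x : ℤ) : sPlusL j [x] = levelLetter j x := by
  simp [sPlusL_cons, sPlusL_nil]

lemma sMinusR_eq (j : ℤ) (d : List ℤ) : sMinusR j d = sPlusL j (negRev d) := by
  simp only [sMinusR, sMinusL, sPlusL, negRev, ← List.map_reverse, List.filterMap_map]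
  congr 1
  funext x
  simp only [Function.comp]
  congr 1
  · exact propext ⟨by omega, by omega⟩
  · congr 1
    exact propext ⟨by omega, by omega⟩

lemma count_N_sPlusL (j : ℤ) (d : List ℤ) : (sPlusL j d).count Step.N = d.count j := by
  induction d with
  | nil => rfl
  | cons x d ih =>
    rw [sPlusL_cons, List.count_append, ih, List.count_cons]
    unfold levelLetter
    split_ifs <;> simp_all; omega

lemma count_E_sPlusL (j : ℤ) (d : List ℤ) : (sPlusL j d).count Step.E = d.count (j + 1) := by
  induction d with
  | nil => rfl
  | cons x d ih =>
    rw [sPlusL_cons, List.count_append, ih, List.count_cons]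
    unfold levelLetter
    split_ifs <;> simp_all; omega

lemma negRev_negRev (d : List ℤ) : negRev (negRev d) = d := by
  simp [negRev, List.map_reverse]

lemma negRev_append (c d : List ℤ) : negRev (c ++ d) = negRev d ++ negRev c := by
  simp [negRev]

lemma negRev_cons (x : ℤ) (d : List ℤ) : negRev (x :: d) = negRev d ++ [-x] := by
  simp [negRev]

lemma length_negRev (d : List ℤ) : (negRev d).length = d.length := by
  simp [negRev]

lemma sPlusL_negRev (j : ℤ) (d : List ℤ) :
    sPlusL j (negRev d) = ((sPlusL (-j - 1) d).map Step.swap).reverse := by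
  induction d with
  | nil => rfl
  | cons x d ih =>
    rw [negRev_cons, sPlusL_append, sPlusL_singleton, ih, sPlusL_cons, List.map_append,
      List.reverse_append]
    congr 1
    unfold levelLetter
    split_ifs <;> first | omega | rfl

lemma count_N_map_swap (l : List Step) : (l.map Step.swap).count Step.N = l.count Step.E := by
  induction l with
  | nil => rfl
  | cons s l ih => cases s <;> simp [Step.swap, ih]

lemma count_E_map_swap (l : List Step) : (l.map Step.swap).count Step.E = l.count Step.N := by
  induction l with
  | nil => rfl
  | cons s l ih => cases s <;> simp [Step.swap, ih]

end Levels

section Gentle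

lemma Gentle.tail {a : ℤ} {d : List ℤ} (h : Gentle (a :: d)) : Gentle d :=
  List.IsChain.tail h

lemma gentle_cons_cons {a b : ℤ} {d : List ℤ} :
    Gentle (a :: b :: d) ↔ a - 1 ≤ b ∧ Gentle (b :: d) := List.isChain_cons_cons

lemma Gentle.negRev {d : List ℤ} (h : Gentle d) : Gentle (negRev d) := by
  unfold Gentle _root_.negRev at *
  rw [List.isChain_reverse, List.isChain_map]
  exact h.imp fun a b hab => by omega

/-- A gentle sequence passes through every level when it descends. -/
lemma Gentle.mem_of_le_of_le {a j x : ℤ} {d : List ℤ} (h : Gentle (a :: d)) (hj : j ≤ a)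
    (hx : x ∈ a :: d) (hxj : x ≤ j) : j ∈ a :: d := by
  induction d generalizing a with
  | nil => simp at hx ⊢; omega
  | cons b d ih =>
    rcases eq_or_ne j a with rfl | hne
    · simp
    · have hab := (gentle_cons_cons.1 h).1
      refine List.mem_cons_of_mem _ (ih h.tail (by omega) ?_)
      rcases List.mem_cons.1 hx with rfl | hx
      · omega
      · exact hx

lemma Gentle.head?_sPlusL {a b : ℤ} {d : List ℤ} (h : Gentle (b :: d)) (hab : a < b)
    (ha : a ∈ d) : (sPlusL a (b :: d)).head? = some Step.E := by
  induction d generalizing b with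
  | nil => simp at ha
  | cons c d ih =>
    have hbc := (gentle_cons_cons.1 h).1
    rw [sPlusL_cons]
    rcases eq_or_ne b (a + 1) with rfl | hne
    · simp [levelLetter]
    · have hl : levelLetter a b = [] := by
        unfold levelLetter; rw [if_neg (by omega), if_neg hne]
      rw [hl, List.nil_append]
      refine ih h.tail (by omega) ?_
      rcases List.mem_cons.1 ha with rfl | ha
      · omega
      · exact ha

lemma head?_sPlusL_self (a : ℤ) (d : List ℤ) : (sPlusL a (a :: d)).head? = some Step.N := by
  simp [sPlusL_cons, levelLetter]

lemma head?_sPlusL_pred (a : ℤ) (d : List ℤ) :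
    (sPlusL (a - 1) (a :: d)).head? = some Step.E := by
  rw [sPlusL_cons, levelLetter, if_neg (by omega), if_pos (by omega)]
  rfl

lemma Gentle.not_lt_of_sPlusL_eq {a b : ℤ} {c d : List ℤ} (hd : Gentle (b :: d))
    (h : sPlusL a (a :: c) = sPlusL a (b :: d)) : ¬ a < b := by
  intro hab
  have hmem : a ∈ b :: d := by
    rw [← List.count_pos_iff, ← count_N_sPlusL, ← h, count_N_sPlusL]
    simp
  have := hd.head?_sPlusL hab ((List.mem_cons.1 hmem).resolve_left hab.ne)
  rw [← h, head?_sPlusL_self] at this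
  simp at this

/-- A gentle sequence is determined by the interleavings of its adjacent levels. -/
lemma Gentle.eq_of_sPlusL_eq {c d : List ℤ} (hc : Gentle c) (hd : Gentle d)
    (h : ∀ j, sPlusL j c = sPlusL j d) : c = d := by
  induction c generalizing d with
  | nil =>
    cases d with
    | nil => rfl
    | cons b d =>
      have := head?_sPlusL_self b d
      rw [← h] at this
      simp [sPlusL] at this
  | cons a c ih =>
    cases d with
    | nil =>
      have := head?_sPlusL_self a c
      rw [h] at this
      simp [sPlusL] at this
    | cons b d =>
      obtain rfl : a = b :=
        le_antisymm (not_lt.1 (hc.not_lt_of_sPlusL_eq (h b).symm))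
          (not_lt.1 (hd.not_lt_of_sPlusL_eq (h a)))
      congr 1
      refine ih hc.tail hd.tail fun j => ?_
      have := h j
      rwa [sPlusL_cons, sPlusL_cons, List.append_cancel_left_eq] at this

lemma head?_eq_N_of_ne {l : List Step} (h0 : l ≠ []) (h : l.head? ≠ some Step.E) :
    l.head? = some Step.N := by
  rcases l with _ | ⟨_ | _, l⟩ <;> simp_all

/-- In a compatible family of words, some entry can be split off as the first one. -/
lemma exists_least_first_level {w : ℤ → List Step}
    (hw : ∀ j, (w j).count Step.E = (w (j + 1)).count Step.N) {lo hi : ℤ}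
    (hlo : ∀ j < lo, w j = []) (hhi : ∀ j, hi < j → w j = []) {b : ℤ} (hb : w b ≠ []) :
    ∃ a, ((w a).head? = some Step.N ∧ (w (a - 1)).head? = some Step.E) ∧
      ∀ c, ((w c).head? = some Step.N ∧ (w (c - 1)).head? = some Step.E) → a ≤ c := by
  have hN : ∃ c, 0 < (w c).count Step.N := by
    have := List.length_pos_of_ne_nil hb
    rw [length_eq_count_add_count, hw b] at this
    rcases Nat.eq_zero_or_pos ((w b).count Step.N) with h | h
    · exact ⟨b + 1, by omega⟩
    · exact ⟨b, h⟩
  obtain ⟨c, hc, hcmin⟩ := Int.exists_least_of_bdd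
    ⟨lo, fun z hz => by by_contra h; simp [hlo z (by omega)] at hz⟩ hN
  have hE : (w (c - 1)).head? = some Step.E := by
    have h1 := hw (c - 1)
    have h2 : (w (c - 1)).count Step.N = 0 := by
      by_contra h
      have := hcmin (c - 1) (by omega)
      omega
    rw [sub_add_cancel] at h1
    rcases hl : w (c - 1) with _ | ⟨_ | _, l⟩
    · rw [hl] at h1
      simp only [List.count_nil] at h1
      omega
    · simp [hl] at h2
    · rfl
  obtain ⟨e, he, hemax⟩ := Int.exists_greatest_of_bdd
    (P := fun c => (w (c - 1)).head? = some Step.E)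
    ⟨hi + 1, fun z hz => by by_contra h; simp [hhi (z - 1) (by omega)] at hz⟩ ⟨c, hE⟩
  have hfirst : (w e).head? = some Step.N := by
    refine head?_eq_N_of_ne (fun h0 => ?_) fun h => ?_
    · have h1 := hw (e - 1)
      rw [sub_add_cancel, h0] at h1
      rcases hl : w (e - 1) with _ | ⟨_ | _, l⟩ <;> simp_all
    · have := hemax (e + 1) (by simpa using h)
      omega
  exact Int.exists_least_of_bdd
    (P := fun a => (w a).head? = some Step.N ∧ (w (a - 1)).head? = some Step.E)
    ⟨lo, fun z hz => by by_contra h; simp [hlo z (by omega)] at hz⟩ ⟨e, hfirst, he⟩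

/-- Every compatible family of words is the family of interleavings of a gentle sequence. -/
lemma exists_gentle {w : ℤ → List Step}
    (hw : ∀ j, (w j).count Step.E = (w (j + 1)).count Step.N) {lo hi : ℤ}
    (hlo : ∀ j < lo, w j = []) (hhi : ∀ j, hi < j → w j = []) :
    ∃ d, Gentle d ∧ ∀ j, sPlusL j d = w j := by
  induction hm : ∑ j ∈ Finset.Icc lo hi, (w j).length using Nat.strong_induction_on
    generalizing w with
  | _ m ih =>
  by_cases h0 : ∀ j, w j = []
  · exact ⟨[], List.isChain_nil, fun j => by rw [h0, sPlusL_nil]⟩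
  push Not at h0
  obtain ⟨b, hb⟩ := h0
  obtain ⟨a, ⟨haN, haE⟩, hmin⟩ := exists_least_first_level hw hlo hhi hb
  have hsplit : ∀ j, ∃ l, w j = levelLetter j a ++ l := by
    intro j
    unfold levelLetter
    split_ifs with h1 h2
    · subst h1
      exact (List.head?_eq_some_iff.1 haN).imp fun _ h => h
    · obtain rfl : j = a - 1 := by omega
      exact (List.head?_eq_some_iff.1 haE).imp fun _ h => h
    · exact ⟨w j, rfl⟩
  choose v hv using hsplit
  have hva : w a = Step.N :: v a := by rw [hv a, levelLetter, if_pos rfl]; rfl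
  have hvlen : ∀ j, (v j).length ≤ (w j).length := fun j => by rw [hv j]; simp
  obtain ⟨d, hd, hdv⟩ := ih (∑ j ∈ Finset.Icc lo hi, (v j).length)
    (by
      rw [← hm]
      refine Finset.sum_lt_sum (fun j _ => hvlen j) ⟨a, ?_, by rw [hva, List.length_cons]; omega⟩
      rw [Finset.mem_Icc]
      constructor <;> by_contra h
      · simp [hlo a (by omega)] at haN
      · simp [hhi a (by omega)] at haN)
    (w := v)
    (fun j => by
      have h1 := hw j
      rw [hv j, hv (j + 1), List.count_append, List.count_append] at h1
      have h2 : (levelLetter j a).count Step.E = (levelLetter (j + 1) a).count Step.N := by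
        unfold levelLetter
        split_ifs <;> first | omega | rfl
      omega)
    (fun j hj => List.eq_nil_of_length_eq_zero
      (Nat.le_zero.1 ((hvlen j).trans_eq (by rw [hlo j hj, List.length_nil]))))
    (fun j hj => List.eq_nil_of_length_eq_zero
      (Nat.le_zero.1 ((hvlen j).trans_eq (by rw [hhi j hj, List.length_nil])))) rfl
  refine ⟨a :: d, ?_, fun j => by rw [sPlusL_cons, hdv, hv j]⟩
  rcases d with _ | ⟨b, d⟩
  · exact List.isChain_singleton _
  · refine gentle_cons_cons.2 ⟨?_, hd⟩
    by_contra hba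
    have hwv : ∀ j, j + 1 < a → w j = v j := fun j hj => by
      rw [hv j, levelLetter, if_neg (by omega), if_neg (by omega), List.nil_append]
    have := hmin b ⟨by rw [hwv b (by omega), ← hdv, head?_sPlusL_self],
      by rw [hwv (b - 1) (by omega), ← hdv, head?_sPlusL_pred]⟩
    omega

end Gentle

section Blocks

variable {w : ℕ → List Step}

/-- The prefixes of `l` contain at least as many North as East steps. -/
def IsBallot (l : List Step) : Prop :=
  ∀ k, (l.take k).count Step.E ≤ (l.take k).count Step.N

/-- The total numbers of steps of a sweep are related by the lowest block. -/
lemma count_N_sweep (hw : ∀ j, (w j).count Step.E = (w (j + 1)).count Step.N) {m : ℕ}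
    (hm : w m = []) :
    (sweep m w).count Step.N = (sweep m w).count Step.E + (w 0).count Step.N := by
  induction m generalizing w with
  | zero => simp [hm, sweep_zero]
  | succ m ih =>
    have := ih (w := fun j => w (j + 1)) (fun j => hw (j + 1)) hm
    rw [sweep_succ', List.count_append, List.count_append, this, hw 0]

lemma isBallot_sweep (hw : ∀ j, (w j).count Step.E = (w (j + 1)).count Step.N) {m : ℕ}
    (hm : w m = []) : IsBallot (sweep m w) := by
  induction m generalizing w with
  | zero => intro k; simp [sweep_zero]
  | succ m ih =>
    have hb := ih (w := fun j => w (j + 1)) (fun j => hw (j + 1)) hm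
    have hc := count_N_sweep (w := fun j => w (j + 1)) (fun j => hw (j + 1)) hm
    intro k
    rw [sweep_succ', List.take_append, List.count_append, List.count_append]
    rcases le_total k (sweep m fun j => w (j + 1)).length with hk | hk
    · rw [Nat.sub_eq_zero_of_le hk]
      simpa using hb k
    · rw [List.take_of_length_le hk, hc, zero_add, ← hw 0]
      have := (List.take_sublist (k - (sweep m fun j => w (j + 1)).length) (w 0)).count_le Step.E
      omega

lemma getLast?_append_ne {u v : List Step} (hu : u.getLast? ≠ some Step.E)
    (hv : v.getLast? ≠ some Step.E) : (u ++ v).getLast? ≠ some Step.E := by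
  rw [List.getLast?_append]
  cases h : v.getLast? <;> simp_all

lemma getLast?_sweep_ne (h : ∀ j, (w j).getLast? ≠ some Step.E) (m : ℕ) :
    (sweep m w).getLast? ≠ some Step.E := by
  induction m with
  | zero => simp [sweep_zero]
  | succ m ih => rw [sweep_succ]; exact getLast?_append_ne (h m) ih

/-- A suffix with a given number of North steps that is preceded by a North step is unique. -/
lemma append_inj_of_count_N {a b u v : List Step} (h : a ++ u = b ++ v)
    (hc : u.count Step.N = v.count Step.N) (ha : a.getLast? ≠ some Step.E)
    (hb : b.getLast? ≠ some Step.E) : a = b ∧ u = v := by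
  have key : ∀ {a c v : List Step}, (c ++ v).count Step.N = v.count Step.N →
      (a ++ c).getLast? ≠ some Step.E → c = [] := by
    intro a c v hc hl
    rcases List.eq_nil_or_concat c with rfl | ⟨c', s, rfl⟩
    · rfl
    · cases s
      · simp at hc; omega
      · simp at hl
  rcases List.append_eq_append_iff.1 h with ⟨c, rfl, rfl⟩ | ⟨c, rfl, rfl⟩
  · obtain rfl := key hc hb
    simp
  · obtain rfl := key hc.symm ha
    simp

/-- The blocks of a sweep can be recovered from the sweep. -/
lemma sweep_injective {v : ℕ → List Step}
    (hw : ∀ j, (w j).count Step.E = (w (j + 1)).count Step.N)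
    (hv : ∀ j, (v j).count Step.E = (v (j + 1)).count Step.N)
    (hwl : ∀ j, (w j).getLast? ≠ some Step.E) (hvl : ∀ j, (v j).getLast? ≠ some Step.E)
    {m : ℕ} (hwm : w m = []) (hvm : v m = []) (h : sweep m w = sweep m v) :
    ∀ j < m, w j = v j := by
  induction m generalizing w v with
  | zero => intro j hj; omega
  | succ m ih =>
    have h1 := count_N_sweep hw hwm
    have h2 := count_N_sweep hv hvm
    rw [h] at h1
    rw [sweep_succ', sweep_succ'] at h
    obtain ⟨h3, h4⟩ := append_inj_of_count_N h (by omega)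
      (getLast?_sweep_ne (fun j => hwl (j + 1)) m) (getLast?_sweep_ne (fun j => hvl (j + 1)) m)
    intro j hj
    rcases j with _ | j
    · exact h4
    · exact ih (w := fun j => w (j + 1)) (v := fun j => v (j + 1)) (fun j => hw (j + 1))
        (fun j => hv (j + 1)) (fun j => hwl (j + 1)) (fun j => hvl (j + 1)) hwm hvm h3 j
        (by omega)

/-- A word containing enough North steps has a suffix with exactly `k` North steps
preceded by a North step. -/
lemma exists_append_count_N (l : List Step) {k : ℕ} (hk : k ≤ l.count Step.N) :
    ∃ a u, l = a ++ u ∧ u.count Step.N = k ∧ a.getLast? ≠ some Step.E := by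
  induction l using List.reverseRecOn generalizing k with
  | nil => exact ⟨[], [], rfl, (Nat.le_zero.1 (by simpa using hk)).symm, by simp⟩
  | append_singleton l s ih =>
    cases s with
    | E =>
      obtain ⟨a, u, rfl, hu, ha⟩ := ih (k := k) (by simpa using hk)
      exact ⟨a, u ++ [Step.E], by simp, by simpa using hu, ha⟩
    | N =>
      rcases k with _ | k
      · exact ⟨l ++ [Step.N], [], by simp, rfl, by simp⟩
      · obtain ⟨a, u, rfl, hu, ha⟩ := ih (k := k) (by simpa using hk)
        exact ⟨a, u ++ [Step.N], by simp, by simpa using hu, ha⟩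

lemma IsBallot.of_append {a u : List Step} (h : IsBallot (a ++ u)) : IsBallot a := by
  intro k
  rcases le_total k a.length with hk | hk
  · simpa [List.take_append_of_le_length hk] using h k
  · have := h a.length
    rw [List.take_append_of_le_length le_rfl, List.take_length] at this
    rwa [List.take_of_length_le hk]

lemma IsBallot.count_le {l : List Step} (h : IsBallot l) :
    l.count Step.E ≤ l.count Step.N := by
  simpa using h l.length

/-- Every ballot path that does not end with an East step is a sweep. -/
lemma exists_blocks {l : List Step} (hl : IsBallot l) (hlast : l.getLast? ≠ some Step.E) :
    ∃ w : ℕ → List Step, (∀ j, (w j).count Step.E = (w (j + 1)).count Step.N) ∧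
      (∀ j, (w j).getLast? ≠ some Step.E) ∧ (∀ j, l.length ≤ j → w j = []) ∧
      ∀ m, l.length ≤ m → sweep m w = l := by
  induction hn : l.length using Nat.strong_induction_on generalizing l with
  | _ n ih =>
  rcases eq_or_ne l [] with rfl | hne
  · refine ⟨fun _ => [], by simp, by simp, by simp, fun m _ => ?_⟩
    induction m with
    | zero => rfl
    | succ m _ => simp_all [sweep]
  have hpos : l.count Step.E < l.count Step.N := by
    rcases List.eq_nil_or_concat l with rfl | ⟨l', s, rfl⟩
    · exact absurd rfl hne
    · cases s
      · have := IsBallot.count_le (IsBallot.of_append (by simpa using hl))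
        simp; omega
      · simp at hlast
  obtain ⟨a, u, rfl, hu, ha⟩ := exists_append_count_N l (k := l.count Step.N - l.count Step.E)
    (Nat.sub_le _ _)
  have hab := hl.of_append
  have hulen : 0 < u.length := by
    rw [length_eq_count_add_count]; omega
  have hlen : (a ++ u).length = a.length + u.length := List.length_append
  obtain ⟨w, hw, hwl, hw0, hws⟩ := ih a.length (by omega) hab ha rfl
  refine ⟨fun j => j.casesOn u w, ?_, ?_, ?_, ?_⟩
  · rintro (_ | j)
    · have h1 := count_N_sweep hw (hw0 a.length le_rfl)
      rw [hws _ le_rfl] at h1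
      rw [List.count_append, List.count_append] at hu hpos
      change u.count Step.E = (w 0).count Step.N
      omega
    · exact hw j
  · rintro (_ | j)
    · rw [List.getLast?_append_of_ne_nil _ (List.ne_nil_of_length_pos hulen)] at hlast
      exact hlast
    · exact hwl j
  · rintro (_ | j) hj
    · omega
    · exact hw0 j (by omega)
  · rintro (_ | m) hm
    · omega
    · rw [sweep_succ']
      exact congrArg (· ++ u) (hws m (by omega))

end Blocks

section Symmetric

/-- The signed word `w` on all integers extending a family of words on natural numbers. -/
def extendBlocks (w : ℕ → List Step) : ℤ → List Step
  | Int.ofNat j => w j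
  | Int.negSucc j => ((w j).map Step.swap).reverse

lemma extendBlocks_neg (w : ℕ → List Step) (j : ℤ) :
    ((extendBlocks w (-j - 1)).map Step.swap).reverse = extendBlocks w j := by
  have hs : ∀ l : List Step, (l.map Step.swap).map Step.swap = l := by
    intro l
    rw [List.map_map]
    conv_rhs => rw [← List.map_id l]
    congr 1
    funext s
    cases s <;> rfl
  rcases j with j | j
  · have : -(Int.ofNat j) - 1 = Int.negSucc j := by
      rw [Int.negSucc_eq]; simp only [Int.ofNat_eq_natCast]; omega
    rw [this]
    simp only [extendBlocks, List.map_reverse, List.reverse_reverse, hs]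
  · have : -(Int.negSucc j) - 1 = Int.ofNat j := by
      rw [Int.negSucc_eq]; simp only [Int.ofNat_eq_natCast]; omega
    rw [this]
    rfl

lemma count_extendBlocks {w : ℕ → List Step}
    (hw : ∀ j, (w j).count Step.E = (w (j + 1)).count Step.N) (j : ℤ) :
    (extendBlocks w j).count Step.E = (extendBlocks w (j + 1)).count Step.N := by
  rcases j with j | _ | j
  · exact hw j
  · simp only [extendBlocks, List.count_reverse, count_E_map_swap]
    rfl
  · have : Int.negSucc (j + 1) + 1 = Int.negSucc j := rfl
    rw [this]
    simp only [extendBlocks, List.count_reverse, count_E_map_swap, count_N_map_swap, hw]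

/-- The symmetric sequence whose right half is `d`. -/
def symmetrize (d : List ℤ) : List ℤ := negRev d ++ d

lemma negRev_symmetrize (d : List ℤ) : negRev (symmetrize d) = symmetrize d := by
  rw [symmetrize, negRev_append, negRev_negRev]

lemma length_symmetrize (d : List ℤ) : (symmetrize d).length = 2 * d.length := by
  simp [symmetrize, length_negRev]; omega

lemma sPlusL_symmetrize (j : ℤ) (d : List ℤ) :
    sPlusL j (symmetrize d) = sMinusR j d ++ sPlusL j d := by
  rw [symmetrize, sPlusL_append, sMinusR_eq]

lemma eq_symmetrize_drop {d : List ℤ} (hd : negRev d = d) {n : ℕ} (hn : d.length = 2 * n) :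
    d = symmetrize (d.drop n) := by
  have h1 := List.take_append_drop n d
  have h2 : negRev (d.drop n) ++ negRev (d.take n) = d.take n ++ d.drop n := by
    rw [← negRev_append, h1, hd]
  have h3 := (List.append_inj h2 (by simp [length_negRev]; omega)).1
  rw [symmetrize, h3, h1]

lemma length_sweep_levelLetter (m : ℕ) (x : ℤ) :
    (sweep m fun j => levelLetter j x).length =
      (if 0 ≤ x ∧ x < m then 1 else 0) + if 1 ≤ x ∧ x ≤ m then 1 else 0 := by
  induction m with
  | zero => rw [sweep_zero, if_neg (by omega), if_neg (by omega)]; rfl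
  | succ m ih =>
    rw [sweep_succ, List.length_append, ih]
    unfold levelLetter
    split_ifs <;> simp <;> omega

lemma length_sweep_sPlusL {m : ℕ} {d : List ℤ} (hm : ∀ x ∈ d, x < m) :
    (sweep m fun j => sPlusL j d).length =
      d.countP (fun x => 0 ≤ x) + d.countP (fun x => 1 ≤ x) := by
  induction d with
  | nil => simp [sPlusL_nil, sweep]
  | cons x d ih =>
    have h := ih fun y hy => hm y (List.mem_cons_of_mem _ hy)
    have hx := hm x List.mem_cons_self
    have h1 := length_sweep_levelLetter m x
    simp only [sPlusL_cons]
    rw [length_eq_count_add_count] at h h1 ⊢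
    rw [count_sweep_append, count_sweep_append, List.countP_cons, List.countP_cons]
    simp only [decide_eq_true_eq]
    split_ifs at h1 ⊢ <;> omega

/-- The sweep of a symmetric sequence has as many letters as the sequence. -/
lemma length_sweep_of_negRev_eq {m : ℕ} {d : List ℤ} (hd : negRev d = d)
    (hm : ∀ x ∈ d, x < m) : (sweep m fun j => sPlusL j d).length = d.length := by
  rw [length_sweep_sPlusL hm, List.length_eq_countP_add_countP (fun x : ℤ => decide (0 ≤ x))]
  congr 1
  conv_lhs => rw [← hd]
  rw [negRev, List.countP_reverse, List.countP_map]
  congr 1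
  funext x
  simp only [Function.comp, decide_eq_true_eq]
  congr 1
  exact propext ⟨by omega, by omega⟩

end Symmetric

section Core

lemma getLast?_negRev (d : List ℤ) : (negRev d).getLast? = d.head?.map Neg.neg := by
  simp [negRev]

lemma Gentle.lt_length {d : List ℤ} (h : Gentle d) (hlast : ∀ x ∈ d.getLast?, x ≤ 0) :
    ∀ x ∈ d, x < d.length := by
  induction d with
  | nil => simp
  | cons a d ih =>
    rcases d with _ | ⟨b, d⟩
    · have := hlast a (by simp)
      intro x hx
      rw [List.mem_singleton.1 hx]
      simp; omega
    · have hih := ih h.tail (by simpa using hlast)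
      have hb := hih b List.mem_cons_self
      have hab := (gentle_cons_cons.1 h).1
      intro x hx
      rw [List.length_cons, Nat.cast_succ]
      rcases List.mem_cons.1 hx with rfl | hx
      · omega
      · have := hih x hx
        omega

lemma Gentle.getLast?_sPlusL_ne {d : List ℤ} (h : Gentle d)
    (hlast : ∀ x ∈ d.getLast?, x ≤ 0) {j : ℤ} (hj : 0 ≤ j) :
    (sPlusL j d).getLast? ≠ some Step.E := by
  induction d with
  | nil => simp [sPlusL_nil]
  | cons a d ih =>
    rcases d with _ | ⟨b, d⟩
    · have := hlast a (by simp)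
      rw [sPlusL_singleton, levelLetter]
      split_ifs
      · simp
      · omega
      · simp
    · have hl : ∀ x ∈ (b :: d).getLast?, x ≤ 0 := by simpa using hlast
      have hih := ih h.tail hl
      rw [sPlusL_cons]
      rcases eq_or_ne (sPlusL j (b :: d)) [] with h0 | h0
      · rw [h0, List.append_nil, levelLetter]
        split_ifs with h1 h2
        · simp
        · exfalso
          have hab := (gentle_cons_cons.1 h).1
          have hmem := Gentle.mem_of_le_of_le (j := j) h.tail (by omega)
            (List.getLast_mem (List.cons_ne_nil b d))
            ((hl _ (List.getLast?_eq_some_getLast (List.cons_ne_nil b d))).trans hj)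
          rw [← List.count_pos_iff, ← count_N_sPlusL, h0] at hmem
          simp at hmem
        · simp
      · rwa [List.getLast?_append_of_ne_nil _ h0]

lemma getLast?_nonpos_of_sPlusL {d : List ℤ}
    (h : ∀ j : ℕ, (sPlusL j d).getLast? ≠ some Step.E) : ∀ x ∈ d.getLast?, x ≤ 0 := by
  intro x hx
  obtain ⟨c, rfl⟩ := List.getLast?_eq_some_iff.1 hx
  by_contra hpos
  refine h (x - 1).toNat ?_
  rw [sPlusL_append, sPlusL_singleton, levelLetter, if_neg (by omega), if_pos (by omega)]
  simp

/-- The sequences of length `n` that do not start below and do not end above level zero and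
drop by at most one at each place. -/
structure IsCore (n : ℕ) (d : List ℤ) : Prop where
  length_eq : d.length = n
  gentle : Gentle d
  head_nonneg : ∀ x ∈ d.head?, 0 ≤ x
  getLast_nonpos : ∀ x ∈ d.getLast?, x ≤ 0

/-- The sweep of the symmetrization of a sequence. -/
def symSweep (m : ℕ) (d : List ℤ) : List Step :=
  sweep m fun j => sPlusL j (symmetrize d)

lemma count_sPlusL_compat (d : List ℤ) (j : ℕ) :
    (sPlusL j d).count Step.E = (sPlusL (j + 1 : ℕ) d).count Step.N := by
  rw [count_E_sPlusL, count_N_sPlusL, Nat.cast_succ]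

variable {n : ℕ} {d : List ℤ}

lemma IsCore.gentle_symmetrize (h : IsCore n d) : Gentle (symmetrize d) := by
  refine List.isChain_append.2 ⟨h.gentle.negRev, h.gentle, fun x hx y hy => ?_⟩
  rw [getLast?_negRev, Option.mem_def.1 hy] at hx
  have hxy : -y = x := by simpa using hx
  have := h.head_nonneg y hy
  omega

lemma getLast?_symmetrize (hd : d ≠ []) : (symmetrize d).getLast? = d.getLast? :=
  List.getLast?_append_of_ne_nil _ hd

lemma IsCore.getLast_symmetrize_nonpos (h : IsCore n d) :
    ∀ x ∈ (symmetrize d).getLast?, x ≤ 0 := by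
  rcases eq_or_ne d [] with rfl | hd
  · simp [symmetrize, negRev]
  · rw [getLast?_symmetrize hd]
    exact h.getLast_nonpos

lemma IsCore.lt_of_mem_symmetrize (h : IsCore n d) : ∀ x ∈ symmetrize d, x < (2 * n : ℕ) := by
  have := h.gentle_symmetrize.lt_length h.getLast_symmetrize_nonpos
  rwa [length_symmetrize, h.length_eq] at this

lemma sPlusL_eq_nil {j : ℤ} (h : ∀ x ∈ d, x < j) : sPlusL j d = [] := by
  refine List.filterMap_eq_nil_iff.2 fun x hx => ?_
  have := h x hx
  rw [if_neg (by omega), if_neg (by omega)]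

lemma IsCore.sPlusL_symmetrize_eq_nil (h : IsCore n d) {j : ℕ} (hj : 2 * n ≤ j) :
    sPlusL j (symmetrize d) = [] :=
  sPlusL_eq_nil fun x hx => (h.lt_of_mem_symmetrize x hx).trans_le (by exact_mod_cast hj)

lemma IsCore.length_symSweep (h : IsCore n d) : (symSweep (2 * n) d).length = 2 * n := by
  rw [symSweep, length_sweep_of_negRev_eq (negRev_symmetrize d) h.lt_of_mem_symmetrize,
    length_symmetrize, h.length_eq]

lemma IsCore.getLast?_sPlusL_ne (h : IsCore n d) (j : ℕ) :
    (sPlusL j (symmetrize d)).getLast? ≠ some Step.E :=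
  h.gentle_symmetrize.getLast?_sPlusL_ne h.getLast_symmetrize_nonpos (by omega)

lemma IsCore.dropLast_symSweep (h : IsCore n d) (hn : 0 < n) :
    (symSweep (2 * n) d).dropLast ++ [Step.N] = symSweep (2 * n) d := by
  have hne : symSweep (2 * n) d ≠ [] :=
    List.ne_nil_of_length_pos (by rw [h.length_symSweep]; omega)
  have hlast : (symSweep (2 * n) d).getLast? ≠ some Step.E :=
    getLast?_sweep_ne h.getLast?_sPlusL_ne _
  conv_rhs => rw [← List.dropLast_append_getLast hne]
  rw [List.getLast?_eq_some_getLast hne] at hlast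
  cases hs : (symSweep (2 * n) d).getLast hne with
  | N => rfl
  | E => exact absurd (congrArg some hs) hlast

lemma IsCore.isBallotPath (h : IsCore n d) :
    IsBallotPath (2 * n - 1) (symSweep (2 * n) d).dropLast := by
  constructor
  · rw [List.length_dropLast, h.length_symSweep]
  · rcases Nat.eq_zero_or_pos n with rfl | hn
    · intro k
      simp [symSweep, sweep_zero]
    · have : IsBallot (symSweep (2 * n) d) :=
        isBallot_sweep (count_sPlusL_compat _) (h.sPlusL_symmetrize_eq_nil le_rfl)
      rw [← h.dropLast_symSweep hn] at this
      exact this.of_append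

lemma sPlusL_eq_of_forall_nat {c d : List ℤ} (hc : negRev c = c) (hd : negRev d = d)
    (h : ∀ j : ℕ, sPlusL j c = sPlusL j d) (j : ℤ) : sPlusL j c = sPlusL j d := by
  rcases j with j | j
  · exact h j
  · rw [← hc, ← hd, sPlusL_negRev, sPlusL_negRev]
    have : -(Int.negSucc j) - 1 = (j : ℤ) := by rw [Int.negSucc_eq]; omega
    rw [this, h]

lemma symmetrize_injective {c d : List ℤ} (hlen : c.length = d.length)
    (h : symmetrize c = symmetrize d) : c = d :=
  (List.append_inj' h hlen).2

lemma IsCore.eq_of_dropLast_eq {c : List ℤ} (hn : 0 < n) (hc : IsCore n c) (hd : IsCore n d)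
    (h : (symSweep (2 * n) c).dropLast = (symSweep (2 * n) d).dropLast) : c = d := by
  have h' : symSweep (2 * n) c = symSweep (2 * n) d := by
    rw [← hc.dropLast_symSweep hn, ← hd.dropLast_symSweep hn, h]
  refine symmetrize_injective (hc.length_eq.trans hd.length_eq.symm)
    (hc.gentle_symmetrize.eq_of_sPlusL_eq hd.gentle_symmetrize
      (sPlusL_eq_of_forall_nat (negRev_symmetrize c) (negRev_symmetrize d) fun j => ?_))
  rcases lt_or_ge j (2 * n) with hj | hj
  · exact sweep_injective (count_sPlusL_compat _) (count_sPlusL_compat _)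
      hc.getLast?_sPlusL_ne hd.getLast?_sPlusL_ne
      (hc.sPlusL_symmetrize_eq_nil le_rfl) (hd.sPlusL_symmetrize_eq_nil le_rfl) h' j hj
  · rw [hc.sPlusL_symmetrize_eq_nil hj, hd.sPlusL_symmetrize_eq_nil hj]

lemma IsBallot.append_N {l : List Step} (h : IsBallot l) : IsBallot (l ++ [Step.N]) := by
  intro k
  have h1 := h k
  have h2 : ([Step.N].take (k - l.length)).count Step.E ≤ [Step.N].count Step.E :=
    (List.take_sublist _ _).count_le _
  have h3 : [Step.N].count Step.E = 0 := rfl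
  rw [List.take_append, List.count_append, List.count_append]
  omega

/-- Every ballot path of odd length comes from a core sequence. -/
lemma exists_core {l : List Step} (hn : 0 < n) (hl : IsBallotPath (2 * n - 1) l) :
    ∃ d, IsCore n d ∧ (symSweep (2 * n) d).dropLast = l := by
  have hlen : (l ++ [Step.N]).length = 2 * n := by
    rw [List.length_append, hl.1, List.length_singleton]; omega
  obtain ⟨w, hw, hwl, hw0, hws⟩ :=
    exists_blocks (IsBallot.append_N (l := l) hl.2) (by simp)
  rw [hlen] at hw0 hws
  have hbig : ∀ j : ℤ, (2 * n : ℕ) ≤ j → extendBlocks w j = [] := by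
    rintro (j | j) hj
    · exact hw0 j (Int.ofNat_le.1 hj)
    · omega
  obtain ⟨d, hd, hdw⟩ := exists_gentle (lo := -(2 * n : ℕ)) (hi := (2 * n : ℕ))
    (count_extendBlocks hw)
    (fun j hj => by
      rw [← extendBlocks_neg, hbig (-j - 1) (by omega)]
      rfl)
    (fun j hj => hbig j hj.le)
  have hsymm : negRev d = d := hd.negRev.eq_of_sPlusL_eq hd fun j => by
    rw [sPlusL_negRev, hdw, hdw, extendBlocks_neg]
  have hbound : ∀ x ∈ d, x < (2 * n : ℕ) := by
    intro x hx
    by_contra h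
    rw [← List.count_pos_iff, ← count_N_sPlusL, hdw, hbig x (by omega)] at hx
    simp at hx
  have hsweep : (sweep (2 * n) fun j => sPlusL j d) = l ++ [Step.N] := by
    rw [← hws _ le_rfl]
    congr 1
    funext j
    exact hdw j
  have hdlen : d.length = 2 * n := by
    rw [← length_sweep_of_negRev_eq hsymm hbound, hsweep, hlen]
  have hd' := eq_symmetrize_drop hsymm hdlen
  have hlen' : (d.drop n).length = n := by rw [List.length_drop]; omega
  have hlast := getLast?_nonpos_of_sPlusL (d := d) fun j => by
    rw [hdw]; exact hwl j
  generalize d.drop n = c at hd' hlen'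
  subst hd'
  obtain ⟨-, hgc, hjoin⟩ := List.isChain_append.1 hd
  refine ⟨c, ⟨hlen', hgc, fun x hx => ?_, ?_⟩, ?_⟩
  · have := hjoin (-x) (by rw [getLast?_negRev, Option.mem_def.1 hx]; rfl) x hx
    omega
  · rwa [getLast?_symmetrize (List.ne_nil_of_length_pos (by omega))] at hlast
  · rw [symSweep, hsweep, List.dropLast_concat]

lemma nthNFollowedByE_append {u v : List Step} {k : ℕ} (hu : u.getLast? = some Step.N)
    (hk : u.count Step.N = k) : NthNFollowedByE (u ++ v) k ↔ v.head? = some Step.E := by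
  obtain ⟨u, rfl⟩ := List.getLast?_eq_some_iff.1 hu
  have hk' : u.count Step.N + 1 = k := by simpa using hk
  constructor
  · rintro ⟨p, hp, hpk, hpE⟩
    have hplen : p = u.length := by
      rcases lt_trichotomy p u.length with h | h | h
      · have h1 : (u.take (p + 1)).count Step.N ≤ u.count Step.N :=
          (List.take_sublist _ _).count_le _
        rw [List.append_assoc, List.getElem?_append_left h] at hp
        rw [List.append_assoc, List.take_append_of_le_length h.le] at hpk
        rw [List.take_add_one, hp] at h1
        simp at h1
        omega
      · exact h
      · rw [List.take_append, List.take_of_length_le (l := u ++ [Step.N]) (by simpa using h),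
          List.count_append, hk] at hpk
        omega
    subst hplen
    rw [List.getElem?_append_right (by simp)] at hpE
    simpa [List.head?_eq_getElem?] using hpE
  · intro hv
    refine ⟨u.length, by simp, by simpa using hk', ?_⟩
    rw [List.getElem?_append_right (by simp)]
    simpa [List.head?_eq_getElem?] using hv

/-- The `n`-th North step of the path of a core sequence is followed by an East step exactly if
the sequence does not start at level zero. -/
lemma IsCore.nthNFollowedByE_iff {x : ℤ} (h : IsCore n (x :: d)) :
    NthNFollowedByE (symSweep (2 * n) (x :: d)).dropLast n ↔ 0 < x := by
  have hn : 0 < n := by rw [← h.length_eq]; simp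
  have hx : 0 ≤ x := h.head_nonneg x rfl
  have hzero : (0 : ℤ) ∈ x :: d :=
    h.gentle.mem_of_le_of_le hx (List.getLast_mem (List.cons_ne_nil x d))
      (h.getLast_nonpos _ (List.getLast?_eq_some_getLast (List.cons_ne_nil x d)))
  set B : ℕ → List Step := fun j => sPlusL j (symmetrize (x :: d)) with hB
  have hcount := count_N_sweep (w := B) (count_sPlusL_compat _)
    (h.sPlusL_symmetrize_eq_nil le_rfl)
  have hlen := h.length_symSweep
  rw [symSweep, length_eq_count_add_count] at hlen
  obtain ⟨m, hm⟩ : ∃ m, 2 * n = m + 1 := ⟨2 * n - 1, by omega⟩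
  have hB0 : B 0 = sPlusL 0 (negRev (x :: d)) ++ sPlusL 0 (x :: d) := by
    simp only [hB, symmetrize, sPlusL_append, Nat.cast_zero]
  have hneg : (negRev (x :: d)).count 0 = (x :: d).count 0 := by
    have := List.count_map_of_injective (x :: d) Neg.neg neg_injective (0 : ℤ)
    rw [negRev, List.count_reverse]
    simpa using this
  have hsplit : symSweep (2 * n) (x :: d) = ((sweep m fun j => B (j + 1)) ++
      sPlusL 0 (negRev (x :: d))) ++ sPlusL 0 (x :: d) := by
    rw [symSweep, hm, sweep_succ', List.append_assoc]
    exact congrArg _ hB0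
  have hsplitB : sweep (2 * n) B = ((sweep m fun j => B (j + 1)) ++
      sPlusL 0 (negRev (x :: d))) ++ sPlusL 0 (x :: d) := hsplit
  have hne : sPlusL 0 (x :: d) ≠ [] := by
    intro h0
    rw [← List.count_pos_iff, ← count_N_sPlusL, h0] at hzero
    simp at hzero
  have hlast : ((sweep m fun j => B (j + 1)) ++ sPlusL 0 (negRev (x :: d))).getLast? =
      some Step.N := by
    have hne' : sPlusL 0 (negRev (x :: d)) ≠ [] := by
      intro h0
      rw [← List.count_pos_iff, ← hneg, ← count_N_sPlusL, h0] at hzero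
      simp at hzero
    rw [List.getLast?_append_of_ne_nil _ hne']
    have hE := h.gentle.negRev.getLast?_sPlusL_ne (j := 0)
      (by simpa [getLast?_negRev] using hx) le_rfl
    rw [List.getLast?_eq_some_getLast hne'] at hE ⊢
    cases hs : (sPlusL 0 (negRev (x :: d))).getLast hne' with
    | N => rfl
    | E => exact absurd (congrArg some hs) hE
  have hcnt : ((sweep m fun j => B (j + 1)) ++ sPlusL 0 (negRev (x :: d))).count Step.N = n := by
    have hlen' : (sweep (2 * n) B).count Step.N + (sweep (2 * n) B).count Step.E = 2 * n := hlen
    rw [hB0, List.count_append, count_N_sPlusL, count_N_sPlusL, hneg] at hcount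
    have h3 := congrArg (List.count Step.N) hsplitB
    rw [List.count_append, count_N_sPlusL 0 (x :: d)] at h3
    omega
  rw [hsplit, List.dropLast_append_of_ne_nil hne, nthNFollowedByE_append hlast hcnt]
  constructor
  · intro hE
    by_contra hx0
    obtain rfl : x = 0 := by omega
    rw [sPlusL_cons, levelLetter, if_pos rfl, List.singleton_append] at hE
    rcases hl : sPlusL 0 d with _ | ⟨s, l⟩ <;> rw [hl] at hE <;> simp at hE
  · intro hx0
    have h0d := (List.mem_cons.1 hzero).resolve_left hx0.ne
    have hE := h.gentle.head?_sPlusL hx0 h0d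
    have hmem : Step.N ∈ sPlusL 0 (x :: d) := by
      rw [← List.count_pos_iff, count_N_sPlusL]
      exact List.count_pos_iff.2 hzero
    rcases hl : sPlusL 0 (x :: d) with _ | ⟨s, _ | ⟨t, l⟩⟩ <;> simp_all

end Core

section Reflection

lemma levelLetter_append_neg (j : ℕ) (x : ℤ) :
    levelLetter j x ++ levelLetter j (-x) = levelLetter j (-x) ++ levelLetter j x := by
  unfold levelLetter
  split_ifs <;> first | rfl | omega

lemma levelLetter_succ_append_neg (j : ℕ) (x : ℤ) :
    levelLetter (j + 1) x ++ levelLetter j (-x) =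
      levelLetter j (-x) ++ levelLetter (j + 1) x := by
  unfold levelLetter
  split_ifs <;> first | rfl | omega

lemma levelLetter_one_sub (j : ℤ) (x : ℤ) : levelLetter (j + 1) (1 - x) = levelLetter j (-x) := by
  unfold levelLetter
  split_ifs <;> first | rfl | omega

/-- The sign of the first entry does not affect the interleavings. -/
lemma sPlusL_symmetrize_neg_cons (j : ℕ) (x : ℤ) (d : List ℤ) :
    sPlusL j (symmetrize (-x :: d)) = sPlusL j (symmetrize (x :: d)) := by
  simp only [symmetrize, negRev_cons, sPlusL_append, sPlusL_cons, sPlusL_nil, List.append_nil,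
    neg_neg, List.append_assoc]
  rw [← List.append_assoc (levelLetter j x), levelLetter_append_neg, List.append_assoc]

lemma sPlusL_symmetrize_concat (j x : ℤ) (d : List ℤ) :
    sPlusL j (symmetrize (d ++ [x])) =
      levelLetter j (-x) ++ sPlusL j (symmetrize d) ++ levelLetter j x := by
  have : negRev [x] = [-x] := rfl
  simp only [symmetrize, negRev_append, sPlusL_append, this, sPlusL_singleton, List.append_assoc]

lemma exists_levelLetter_append_symSweep (m : ℕ) (x : ℤ) (d : List ℤ) :
    ∃ l, levelLetter m x ++ symSweep m (d ++ [x]) = l ++ levelLetter 0 x ∧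
      levelLetter m (1 - x) ++ symSweep m (d ++ [1 - x]) = l ++ levelLetter 0 (1 - x) := by
  induction m with
  | zero => exact ⟨[], by simp [symSweep, sweep_zero], by simp [symSweep, sweep_zero]⟩
  | succ m ih =>
    obtain ⟨l, h1, h2⟩ := ih
    have step : ∀ y : ℤ, levelLetter (m + 1 : ℕ) y ++ symSweep (m + 1) (d ++ [y]) =
        levelLetter m (-y) ++ levelLetter (m + 1) y ++ sPlusL m (symmetrize d) ++
          (levelLetter m y ++ symSweep m (d ++ [y])) := by
      intro y
      rw [symSweep, sweep_succ, sPlusL_symmetrize_concat, ← levelLetter_succ_append_neg,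
        Nat.cast_succ]
      simp only [symSweep, List.append_assoc]
    refine ⟨levelLetter m (-x) ++ levelLetter (m + 1) x ++ sPlusL m (symmetrize d) ++ l, ?_, ?_⟩
    · rw [step, h1, List.append_assoc _ l]
    · have h3 : levelLetter m (-(1 - x)) = levelLetter (m + 1) x := by
        rw [← levelLetter_one_sub]; congr 1; omega
      rw [step, h2, levelLetter_one_sub, h3, ← levelLetter_succ_append_neg, List.append_assoc _ l]

/-- Reflecting the last entry in `1 / 2` affects at most the last letter. -/
lemma dropLast_symSweep_concat_one_sub {m : ℕ} {x : ℤ} (hx : x < m) (hx' : 1 - x < m)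
    (d : List ℤ) :
    (symSweep m (d ++ [1 - x])).dropLast = (symSweep m (d ++ [x])).dropLast := by
  obtain ⟨l, h1, h2⟩ := exists_levelLetter_append_symSweep m x d
  have h0 : ∀ y : ℤ, y < m → levelLetter m y = [] := fun y hy => by
    rw [levelLetter, if_neg (by omega), if_neg (by omega)]
  rw [h0 _ hx, List.nil_append] at h1
  rw [h0 _ hx', List.nil_append] at h2
  rw [h1, h2]
  unfold levelLetter
  split_ifs <;> first | omega | simp

end Reflection

section Paths

lemma ebn_zero (l : List Step) : ebn l 0 = 0 := by
  rcases l with _ | ⟨_ | _, l⟩ <;> rfl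

lemma ebn_le_count (l : List Step) (k : ℕ) : ebn l k ≤ l.count Step.E := by
  induction l generalizing k with
  | nil => cases k <;> simp [ebn]
  | cons s l ih =>
    cases k with
    | zero => simp [ebn]
    | succ k =>
      cases s
      · simpa [ebn] using ih k
      · simpa [ebn] using ih (k + 1)

lemma ebn_le_succ (l : List Step) (k : ℕ) : ebn l k ≤ ebn l (k + 1) := by
  induction l generalizing k with
  | nil => cases k <;> simp [ebn]
  | cons s l ih =>
    cases k with
    | zero => simp [ebn_zero]
    | succ k =>
      cases s
      · simpa [ebn] using ih k
      · simpa [ebn] using ih (k + 1)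

/-- A lattice path is determined by the numbers of East steps preceding its North steps. -/
lemma IsLatticePath.eq_of_ebn_eq {a b : ℕ} {l l' : List Step} (h : IsLatticePath a b l)
    (h' : IsLatticePath a b l') (he : ∀ k, 1 ≤ k → k ≤ b → ebn l k = ebn l' k) : l = l' := by
  unfold IsLatticePath at h h'
  induction l generalizing a b l' with
  | nil =>
    have h1 := length_eq_count_add_count l'
    simp only [List.count_nil] at h
    exact (List.eq_nil_of_length_eq_zero (by omega)).symm
  | cons s l ih =>
    rcases l' with _ | ⟨s', l'⟩
    · simp only [List.count_nil] at h'
      cases s <;> simp at h <;> omega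
    · cases s <;> cases s' <;> simp at h h'
      · congr 1
        refine ih (a := a) (b := b - 1) ⟨by omega, by omega⟩ ⟨by omega, by omega⟩
          fun k hk hkb => ?_
        simpa [ebn] using he (k + 1) (by omega) (by omega)
      · have := he 1 le_rfl (by omega)
        simp [ebn, ebn_zero] at this
      · have := he 1 le_rfl (by omega)
        simp [ebn, ebn_zero] at this
      · congr 1
        refine ih (a := a - 1) (b := b) ⟨by omega, by omega⟩ ⟨by omega, by omega⟩
          fun k hk hkb => ?_
        obtain ⟨k, rfl⟩ := Nat.exists_eq_add_of_le' hk
        simpa [ebn] using he (k + 1) hk hkb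

lemma exists_latticePath_ebn (a b : ℕ) (f : ℕ → ℕ)
    (hf : ∀ k, 1 ≤ k → k < b → f k ≤ f (k + 1)) (ha : ∀ k, 1 ≤ k → k ≤ b → f k ≤ a) :
    ∃ l, IsLatticePath a b l ∧ ∀ k, 1 ≤ k → k ≤ b → ebn l k = f k := by
  induction hm : a + b generalizing a b f with
  | zero =>
    obtain ⟨rfl, rfl⟩ : a = 0 ∧ b = 0 := by omega
    exact ⟨[], ⟨rfl, rfl⟩, fun k h1 h2 => by omega⟩
  | succ m ih =>
    by_cases h1 : 1 ≤ b ∧ f 1 = 0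
    · obtain ⟨l, ⟨hla, hlb⟩, hl⟩ := ih a (b - 1) (fun k => f (k + 1))
        (fun k h1 h2 => hf (k + 1) (by omega) (by omega))
        (fun k h1 h2 => ha (k + 1) (by omega) (by omega)) (by omega)
      refine ⟨Step.N :: l, ⟨by simpa using hla, by simp; omega⟩, fun k hk hkb => ?_⟩
      obtain ⟨k, rfl⟩ := Nat.exists_eq_add_of_le' hk
      rw [ebn]
      rcases k with _ | k
      · rw [ebn_zero, h1.2]
      · exact hl (k + 1) (by omega) (by omega)
    · have hpos : ∀ k, 1 ≤ k → k ≤ b → 1 ≤ f k := by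
        intro k hk
        induction k, hk using Nat.le_induction with
        | base => intro hb; omega
        | succ k hk ihk => intro hkb; exact (ihk (by omega)).trans (hf k hk (by omega))
      have hapos : 1 ≤ a := by
        rcases Nat.eq_zero_or_pos b with hb | hb
        · omega
        · exact (hpos 1 le_rfl hb).trans (ha 1 le_rfl hb)
      obtain ⟨l, ⟨hla, hlb⟩, hl⟩ := ih (a - 1) b (fun k => f k - 1)
        (fun k h1 h2 => Nat.sub_le_sub_right (hf k h1 h2) 1)
        (fun k h1 h2 => Nat.sub_le_sub_right (ha k h1 h2) 1) (by omega)
      refine ⟨Step.E :: l, ⟨by simp; omega, by simpa using hlb⟩, fun k hk hkb => ?_⟩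
      have := hl k hk hkb
      have := hpos k hk hkb
      obtain ⟨k, rfl⟩ := Nat.exists_eq_add_of_le' hk
      rw [ebn]
      omega

lemma head?_eq_N_iff_ebn {l : List Step} (hl : 1 ≤ l.count Step.N) :
    l.head? = some Step.N ↔ ebn l 1 = 0 := by
  rcases l with _ | ⟨_ | _, l⟩
  · simp at hl
  · simp [ebn, ebn_zero]
  · simp [ebn]

end Paths

section AreaVector

lemma map_range_add_two {α : Type*} (m : ℕ) (g : ℕ → α) :
    (List.range (m + 2)).map g =
      g 0 :: ((List.range m).map (fun k => g (k + 1)) ++ [g (m + 1)]) := by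
  rw [List.range_succ_eq_map, List.range_succ]
  simp [Function.comp_def]

lemma isCore_map_range_iff {m : ℕ} {g : ℕ → ℤ} :
    IsCore (m + 2) ((List.range (m + 2)).map g) ↔
      0 ≤ g 0 ∧ g (m + 1) ≤ 0 ∧ ∀ k ≤ m, g k - 1 ≤ g (k + 1) := by
  have hhead : ((List.range (m + 2)).map g).head? = some (g 0) := by
    rw [map_range_add_two]; rfl
  have hlast : ((List.range (m + 2)).map g).getLast? = some (g (m + 1)) := by
    rw [List.range_succ]; simp
  have hgentle : Gentle ((List.range (m + 2)).map g) ↔ ∀ k ≤ m, g k - 1 ≤ g (k + 1) := by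
    rw [Gentle, List.isChain_iff_getElem]
    simp only [List.length_map, List.length_range, List.getElem_map, List.getElem_range]
    exact ⟨fun h k hk => h k (by omega), fun h k hk => h k (by omega)⟩
  constructor
  · intro h
    exact ⟨h.head_nonneg _ hhead, h.getLast_nonpos _ hlast, hgentle.1 h.gentle⟩
  · rintro ⟨h1, h2, h3⟩
    exact ⟨by simp, hgentle.2 h3, by rw [hhead]; simpa using h1, by rw [hlast]; simpa using h2⟩

/-- The core sequence of a lattice path: its type `D` area vector up to the sign of the first entry
and a reflection of the last entry. -/
def coreEntry (m : ℕ) (l : List Step) (k : ℕ) : ℤ :=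
  if k = m + 1 then
    min (2 * (ebn l (m + 2) : ℤ) - ebn l (m + 1) - (m + 1))
      (1 - (2 * (ebn l (m + 2) : ℤ) - ebn l (m + 1) - (m + 1)))
  else (ebn l (k + 1) : ℤ) - k

def coreList (m : ℕ) (l : List Step) : List ℤ := (List.range (m + 2)).map (coreEntry m l)

variable {m : ℕ} {l : List Step}

lemma coreEntry_zero : coreEntry m l 0 = ebn l 1 := by
  simp [coreEntry]

lemma isCore_coreList (hl : IsLatticePath (m + 1) (m + 2) l) : IsCore (m + 2) (coreList m l) := by
  refine isCore_map_range_iff.2 ⟨?_, ?_, fun k hk => ?_⟩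
  · rw [coreEntry_zero]; omega
  · rw [coreEntry, if_pos rfl]; omega
  · have h1 : ebn l (k + 1) ≤ ebn l (k + 2) := ebn_le_succ l (k + 1)
    have h2 := ebn_le_count l (k + 2)
    rw [hl.1] at h2
    unfold coreEntry
    rw [if_neg (by omega)]
    split_ifs with h
    · obtain rfl : k = m := by omega
      omega
    · rw [show k + 1 + 1 = k + 2 from rfl]
      push_cast; omega

lemma coreList_injective {l' : List Step} (hl : IsLatticePath (m + 1) (m + 2) l)
    (hl' : IsLatticePath (m + 1) (m + 2) l') (h : coreList m l = coreList m l') : l = l' := by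
  have hk : ∀ k < m + 2, coreEntry m l k = coreEntry m l' k := by
    simpa [coreList] using h
  have hlow : ∀ k, 1 ≤ k → k ≤ m + 1 → ebn l k = ebn l' k := by
    intro k h1 h2
    obtain ⟨k, rfl⟩ := Nat.exists_eq_add_of_le' h1
    have := hk k (by omega)
    rw [coreEntry, coreEntry, if_neg (by omega), if_neg (by omega)] at this
    omega
  refine hl.eq_of_ebn_eq hl' fun k h1 h2 => ?_
  rcases eq_or_ne k (m + 2) with rfl | hne
  · have h3 := hk (m + 1) (by omega)
    have h4 := hlow (m + 1) (by omega) le_rfl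
    rw [coreEntry, coreEntry, if_pos rfl, if_pos rfl] at h3
    omega
  · exact hlow k h1 (by omega)

lemma exists_coreList_eq {d : List ℤ} (hd : IsCore (m + 2) d) :
    ∃ l, IsLatticePath (m + 1) (m + 2) l ∧ coreList m l = d := by
  obtain ⟨g, rfl⟩ : ∃ g : ℕ → ℤ, d = (List.range (m + 2)).map g :=
    ⟨fun k => d.getD k 0, List.ext_getElem (by simp [hd.length_eq]) fun k h1 h2 => by
      simp [List.getElem?_eq_getElem h1]⟩
  obtain ⟨h0, hlast, hstep⟩ := isCore_map_range_iff.1 hd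
  have hlow : ∀ k ≤ m + 1, 0 ≤ g k + k := by
    intro k
    induction k with
    | zero => intro _; simpa using h0
    | succ k ih =>
      intro hk
      have := ih (by omega)
      have := hstep k (by omega)
      push_cast; omega
  have hhigh : ∀ j ≤ m + 1, g (m + 1 - j) ≤ j := by
    intro j
    induction j with
    | zero => intro _; simpa using hlast
    | succ j ih =>
      intro hj
      have h1 := ih (by omega)
      have h2 := hstep (m + 1 - (j + 1)) (by omega)
      rw [show m + 1 - (j + 1) + 1 = m + 1 - j by omega] at h2
      rw [Nat.cast_succ]
      linarith
  have hup : ∀ k ≤ m + 1, g k + k ≤ m + 1 := by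
    intro k hk
    have := hhigh (m + 1 - k) (by omega)
    rw [show m + 1 - (m + 1 - k) = k by omega] at this
    omega
  obtain ⟨q, hq1, hq2, hq3⟩ : ∃ q : ℕ, g m + m ≤ q ∧ q ≤ m + 1 ∧
      min (2 * (q : ℤ) - (g m + m) - (m + 1)) (1 - (2 * (q : ℤ) - (g m + m) - (m + 1))) =
        g (m + 1) := by
    have h1 := hlow m (by omega)
    have h2 := hlow (m + 1) le_rfl
    have h3 := hstep m le_rfl
    rcases Int.emod_two_eq_zero_or_one (g m + g (m + 1) + 1) with h | h
    · exact ⟨((g (m + 1) + (m + 1) + (g m + m)) / 2).toNat, by omega, by omega, by omega⟩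
    · exact ⟨((2 * m + 3 - (g (m + 1) + (m + 1)) + (g m + m)) / 2).toNat, by omega, by omega,
        by omega⟩
  obtain ⟨l, hl, hle⟩ := exists_latticePath_ebn (m + 1) (m + 2)
    (fun k => if k = m + 2 then q else (g (k - 1) + (k - 1 : ℕ)).toNat)
    (fun k h1 h2 => by
      obtain ⟨k, rfl⟩ := Nat.exists_eq_add_of_le' h1
      have h3 := hstep k (by omega)
      simp only [Nat.add_sub_cancel]
      rw [if_neg (by omega)]
      split_ifs with h
      · obtain rfl : k = m := by omega
        omega
      · push_cast; omega)
    (fun k h1 h2 => by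
      obtain ⟨k, rfl⟩ := Nat.exists_eq_add_of_le' h1
      simp only [Nat.add_sub_cancel]
      split_ifs with h
      · exact hq2
      · have := hup k (by omega)
        omega)
  refine ⟨l, hl, List.map_congr_left fun k hk => ?_⟩
  have hk' := List.mem_range.1 hk
  have hle' : ∀ k ≤ m, (ebn l (k + 1) : ℤ) = g k + k := by
    intro k hk
    have := hle (k + 1) (by omega) (by omega)
    simp only [Nat.add_sub_cancel] at this
    rw [if_neg (by omega)] at this
    have := hlow k (by omega)
    omega
  unfold coreEntry
  split_ifs with h
  · subst h
    rw [hle (m + 2) (by omega) le_rfl, if_pos rfl, hle' m le_rfl, hq3]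
  · rw [hle' k (by omega)]; omega

lemma symSweep_neg_cons (k : ℕ) (x : ℤ) (d : List ℤ) :
    symSweep k (-x :: d) = symSweep k (x :: d) := by
  simp only [symSweep, sPlusL_symmetrize_neg_cons]

variable {π : SPath}

lemma areaD_one_eq_or (hπ : π.sgn = 1 ∨ π.sgn = -1) :
    areaD (m + 2) π 1 = coreEntry m π.path 0 ∨ areaD (m + 2) π 1 = -coreEntry m π.path 0 := by
  rw [coreEntry_zero]
  rcases hπ with h | h <;> simp only [areaD, lamD, h, if_true] <;> split_ifs <;> simp

lemma areaD_last_eq_or :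
    areaD (m + 2) π (m + 2) = coreEntry m π.path (m + 1) ∨
      areaD (m + 2) π (m + 2) = 1 - coreEntry m π.path (m + 1) := by
  simp only [areaD, lamD, coreEntry, if_true, if_neg (show ¬ m + 2 = 1 by omega),
    show m + 2 - 1 = m + 1 from rfl]
  split_ifs <;> push_cast <;> omega

lemma areaD_middle {k : ℕ} (hk : k < m) :
    areaD (m + 2) π (k + 2) = coreEntry m π.path (k + 1) := by
  simp only [areaD, lamD, coreEntry, if_neg (show ¬ k + 2 = 1 by omega),
    if_neg (show ¬ k + 2 = m + 2 by omega), if_neg (show ¬ k + 1 = m + 1 by omega)]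
  push_cast; ring

lemma zetaDraw_eq (hπ : IsSignedLatticePath (m + 2) π) :
    zetaDraw (m + 2) π = (symSweep (2 * (m + 2)) (coreList m π.path)).dropLast := by
  have hcore := isCore_coreList (m := m) hπ.1
  have hraw : zetaDraw (m + 2) π =
      (symSweep (2 * (m + 2)) (areaDList (m + 2) π)).dropLast := by
    simp [zetaDraw, symSweep, sweep, sPlusL_symmetrize, ← List.map_eq_flatMap, Function.comp_def]
  have hlow := ebn_le_count π.path (m + 2)
  have hlast := (isCore_map_range_iff.1 hcore).2.1
  have hge : -((m : ℤ) + 1) ≤ coreEntry m π.path (m + 1) := by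
    have h1 : ebn π.path (m + 1) ≤ ebn π.path (m + 2) := ebn_le_succ π.path (m + 1)
    rw [hπ.1.1] at hlow
    rw [coreEntry, if_pos rfl]
    omega
  have hmid : (List.range m).map (fun k => areaD (m + 2) π (k + 1 + 1)) =
      (List.range m).map (fun k => coreEntry m π.path (k + 1)) :=
    List.map_congr_left fun k hk => areaD_middle (List.mem_range.1 hk)
  rw [hraw, areaDList, coreList, map_range_add_two, map_range_add_two, hmid, zero_add]
  set D := (List.range m).map (fun k => coreEntry m π.path (k + 1))
  have hfirst : ∀ D' : List ℤ, symSweep (2 * (m + 2)) (areaD (m + 2) π 1 :: D') =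
      symSweep (2 * (m + 2)) (coreEntry m π.path 0 :: D') := by
    intro D'
    rcases areaD_one_eq_or (m := m) hπ.2.1 with h | h <;> rw [h]
    exact symSweep_neg_cons _ _ _
  rw [hfirst]
  rcases areaD_last_eq_or (m := m) (π := π) with h | h <;> rw [h]
  exact dropLast_symSweep_concat_one_sub (by push_cast; omega) (by push_cast; omega)
    (coreEntry m π.path 0 :: D)

lemma areaD_neg_one {n : ℕ} (l : List Step) : areaD n ⟨l, -1⟩ 1 = -areaD n ⟨l, 1⟩ 1 := by
  simp only [areaD, lamD, if_true]
  split_ifs <;> ring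

lemma areaD_eq_of_ne_one {n r : ℕ} (hr : r ≠ 1) (l : List Step) (s t : ℤ) :
    areaD n ⟨l, s⟩ r = areaD n ⟨l, t⟩ r := by
  rcases eq_or_ne r n with rfl | h
  · simp only [areaD, lamD, if_neg hr, if_true]
  · simp only [areaD, lamD, if_neg hr, if_neg h]

lemma areaD_one_ne_zero {n : ℕ} (h : ebn l 1 ≠ 0) : areaD n ⟨l, 1⟩ 1 ≠ 0 := by
  simp only [areaD, lamD, if_true]
  split_ifs <;> omega

/-- Changing the sign of a path changes the parity of the number of positive entries of its area
vector. -/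
lemma card_pos_areaD_mod_two_ne {n : ℕ} (hn : 1 ≤ n) (h : ebn l 1 ≠ 0) :
    ((Finset.Icc 1 n).filter (fun r => 0 < areaD n ⟨l, 1⟩ r)).card % 2 ≠
      ((Finset.Icc 1 n).filter (fun r => 0 < areaD n ⟨l, -1⟩ r)).card % 2 := by
  have h1 : 1 ∈ Finset.Icc 1 n := Finset.mem_Icc.2 ⟨le_rfl, hn⟩
  have h0 := areaD_one_ne_zero (n := n) h
  rw [Finset.card_filter, Finset.card_filter, ← Finset.add_sum_erase _ _ h1,
    ← Finset.add_sum_erase _ _ h1, areaD_neg_one,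
    Finset.sum_congr rfl fun r hr => by
      rw [areaD_eq_of_ne_one (Finset.ne_of_mem_erase hr) l 1 (-1)]]
  split_ifs <;> omega

lemma nthNFollowedByE_zetaDraw_iff (hπ : IsSignedLatticePath (m + 2) π) :
    NthNFollowedByE (zetaDraw (m + 2) π) (m + 2) ↔ ebn π.path 1 ≠ 0 := by
  have hcore := isCore_coreList (m := m) hπ.1
  rw [zetaDraw_eq hπ]
  rw [coreList, map_range_add_two] at hcore ⊢
  rw [hcore.nthNFollowedByE_iff, coreEntry_zero]
  omega

end AreaVector

/-- For every `n ≥ 2`, the type `Dₙ` zeta map is a bijection from signed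
lattice paths `L•_{n-1,n}` onto signed ballot paths `B•_{2n-1}`. -/
theorem zetaD_bijOn (n : ℕ) (hn : 2 ≤ n) :
    Set.BijOn (zetaD n) {π : SPath | IsSignedLatticePath n π}
      {β : SPath | IsSignedBallotPath n β} := by
  obtain ⟨m, rfl⟩ := Nat.exists_eq_add_of_le' hn
  have hsgn : ∀ π : SPath, IsSignedLatticePath (m + 2) π → ebn π.path 1 = 0 → π.sgn = 1 :=
    fun π hπ h => hπ.2.2 ((head?_eq_N_iff_ebn (by rw [hπ.1.2]; omega)).2 h)
  refine ⟨?_, ?_, ?_⟩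
  · intro π hπ
    refine ⟨?_, ?_, fun h => if_neg h⟩
    · simp only [zetaD]
      rw [zetaDraw_eq hπ]
      exact (isCore_coreList (m := m) hπ.1).isBallotPath
    · simp only [zetaD]
      split_ifs <;> simp
  · rintro ⟨l, s⟩ hπ ⟨l', s'⟩ hπ' h
    have hpath := congrArg SPath.path h
    simp only [zetaD] at hpath
    rw [zetaDraw_eq hπ, zetaDraw_eq hπ'] at hpath
    obtain rfl : l = l' := coreList_injective hπ.1 hπ'.1
      ((isCore_coreList hπ.1).eq_of_dropLast_eq (by omega) (isCore_coreList hπ'.1) hpath)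
    congr 1
    by_cases h0 : ebn l 1 = 0
    · exact (hsgn _ hπ h0).trans (hsgn _ hπ' h0).symm
    · have hs := congrArg SPath.sgn h
      have hne := card_pos_areaD_mod_two_ne (n := m + 2) (by omega) h0
      simp only [zetaD] at hs
      rw [if_pos ((nthNFollowedByE_zetaDraw_iff hπ).2 h0),
        if_pos ((nthNFollowedByE_zetaDraw_iff hπ').2 h0)] at hs
      rcases hπ.2.1 with h1 | h1 <;> rcases hπ'.2.1 with h2 | h2 <;> simp only at h1 h2 <;>
        subst h1 <;> subst h2
      · rfl
      · split_ifs at hs <;> omega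
      · split_ifs at hs <;> omega
      · rfl
  · rintro ⟨b, t⟩ hβ
    obtain ⟨d, hd, hdb⟩ := exists_core (by omega) hβ.1
    obtain ⟨l, hl, rfl⟩ := exists_coreList_eq hd
    simp only at hdb
    subst hdb
    by_cases h0 : ebn l 1 = 0
    · have hπ : IsSignedLatticePath (m + 2) ⟨l, 1⟩ := ⟨hl, Or.inl rfl, fun _ => rfl⟩
      have hN := (nthNFollowedByE_zetaDraw_iff hπ).not.2 (not_not.2 h0)
      refine ⟨⟨l, 1⟩, hπ, ?_⟩
      rw [zetaD, if_neg hN]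
      rw [zetaDraw_eq hπ] at hN ⊢
      rw [show t = 1 from hβ.2.2 hN]
    · have hπ : ∀ s, s = 1 ∨ s = -1 → IsSignedLatticePath (m + 2) ⟨l, s⟩ := fun s hs =>
        ⟨hl, hs, fun h => absurd ((head?_eq_N_iff_ebn (by rw [hl.2]; omega)).1 h) h0⟩
      have hval : ∀ s, s = 1 ∨ s = -1 → zetaD (m + 2) ⟨l, s⟩ =
          ⟨(symSweep (2 * (m + 2)) (coreList m l)).dropLast,
            if ((Finset.Icc 1 (m + 2)).filter
              (fun r => 0 < areaD (m + 2) ⟨l, s⟩ r)).card % 2 = 0 then 1 else -1⟩ := by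
        intro s hs
        rw [zetaD, if_pos ((nthNFollowedByE_zetaDraw_iff (hπ s hs)).2 h0),
          zetaDraw_eq (hπ s hs)]
      have hne := card_pos_areaD_mod_two_ne (n := m + 2) (by omega) h0
      have ht : t = 1 ∨ t = -1 := hβ.2.1
      have hex : ∃ s : ℤ, (s = 1 ∨ s = -1) ∧ (if ((Finset.Icc 1 (m + 2)).filter
          (fun r => 0 < areaD (m + 2) ⟨l, s⟩ r)).card % 2 = 0 then (1 : ℤ) else -1) = t := by
        by_contra! hcon
        have h1 := hcon 1 (Or.inl rfl)
        have h2 := hcon (-1) (Or.inr rfl)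
        split_ifs at h1 h2 <;> omega
      obtain ⟨s, hs, hst⟩ := hex
      exact ⟨⟨l, s⟩, hπ s hs, by rw [hval s hs, hst]⟩
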